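/- As c → ∞, c · ∫₀^∞ √(2/π)·e^{−x²}·H₂(Φ(c·x)) dx converges to √(2/π)·α, where α = ∫₀^∞ H₂(Φ(x)) dx. (The integral on the left equals the conditional entropy I(h(q)|f(p)) of the sign bit h(q) of a one-dimensional Gaussian projection of a point q at distance 1/c from p, given the projected value f(p) of a point p at distance 1/√2 from the origin.) -/

import Mathlib

open MeasureTheory Filter

/-- `Φ(x)`: the upper tail of the standard normal distribution. -/
noncomputable def stdNormalTail (x : ℝ) : ℝ :=
  (Real.sqrt (2 * Real.pi))⁻¹ * ∫ t in Set.Ioi x, Real.exp (-(t ^ 2) / 2)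

/-- Binary entropy function (base 2), with the convention `0 · log₂ 0 = 0`. -/
noncomputable def binEnt (w : ℝ) : ℝ :=
  -(w * Real.logb 2 w) - (1 - w) * Real.logb 2 (1 - w)

lemma integrable_exp_neg_sq_div_two : Integrable fun t : ℝ => Real.exp (-(t ^ 2) / 2) := by
  convert integrable_exp_neg_mul_sq (b := 1 / 2) (by norm_num) using 3
  ring

lemma integral_exp_neg_sq_div_two :
    ∫ t : ℝ, Real.exp (-(t ^ 2) / 2) = Real.sqrt (2 * Real.pi) := by
  convert integral_gaussian (1 / 2) using 3
  · ring_nf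
  · ring

lemma stdNormalTail_nonneg (x : ℝ) : 0 ≤ stdNormalTail x :=
  mul_nonneg (by positivity) (integral_nonneg fun _ => (Real.exp_pos _).le)

lemma stdNormalTail_le_one (x : ℝ) : stdNormalTail x ≤ 1 := by
  have h : ∫ t in Set.Ioi x, Real.exp (-(t ^ 2) / 2) ≤ Real.sqrt (2 * Real.pi) :=
    integral_exp_neg_sq_div_two ▸ setIntegral_le_integral integrable_exp_neg_sq_div_two
      (Eventually.of_forall fun _ => (Real.exp_pos _).le)
  have hpos : 0 < Real.sqrt (2 * Real.pi) := by positivity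
  rw [stdNormalTail, inv_mul_le_iff₀ hpos, mul_one]
  exact h

lemma antitone_stdNormalTail : Antitone stdNormalTail := fun _ _ h =>
  mul_le_mul_of_nonneg_left
    (setIntegral_mono_set integrable_exp_neg_sq_div_two.integrableOn
      (Eventually.of_forall fun _ => (Real.exp_pos _).le)
      (Set.Ioi_subset_Ioi h).eventuallyLE)
    (by positivity)

lemma stdNormalTail_le_exp (x : ℝ) : stdNormalTail x ≤ Real.exp (1 / 2 - x) := by
  have hexp (t : ℝ) : Real.exp (1 / 2 - t) = Real.exp (1 / 2) * Real.exp (-t) := by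
    rw [← Real.exp_add, sub_eq_add_neg]
  have hint : ∫ t in Set.Ioi x, Real.exp (-(t ^ 2) / 2) ≤ Real.exp (1 / 2 - x) := by
    calc
      _ ≤ ∫ t in Set.Ioi x, Real.exp (1 / 2) * Real.exp (-t) := by
        refine setIntegral_mono integrable_exp_neg_sq_div_two.integrableOn
          ((integrableOn_exp_neg_Ioi x).const_mul _) fun t => ?_
        simp only [← hexp]
        exact Real.exp_le_exp.2 (by nlinarith [sq_nonneg (t - 1)])
      _ = _ := by rw [integral_const_mul, integral_exp_neg_Ioi, ← hexp]
  have hone : (Real.sqrt (2 * Real.pi))⁻¹ ≤ 1 :=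
    inv_le_one_of_one_le₀ (Real.one_le_sqrt.2 (by linarith [Real.pi_gt_three]))
  exact (mul_le_of_le_one_left (integral_nonneg fun _ => (Real.exp_pos _).le) hone).trans hint

lemma binEnt_eq_binEntropy_div (w : ℝ) : binEnt w = Real.binEntropy w / Real.log 2 := by
  simp only [binEnt, Real.logb, Real.binEntropy, Real.log_inv]
  ring

lemma binEntropy_le_three_mul_sqrt {w : ℝ} (h0 : 0 ≤ w) (h1 : w ≤ 1) :
    Real.binEntropy w ≤ 3 * Real.sqrt w := by
  rcases h0.eq_or_lt with rfl | hpos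
  · simp
  rcases h1.eq_or_lt with rfl | hlt
  · simp
  have hs : 0 < Real.sqrt w := Real.sqrt_pos.2 hpos
  have hsq : Real.sqrt w * Real.sqrt w = w := Real.mul_self_sqrt h0
  have hs1 : Real.sqrt w ≤ 1 := Real.sqrt_le_one.2 h1
  have hleft : w * Real.log w⁻¹ ≤ 2 * Real.sqrt w := by
    have h := Real.log_le_sub_one_of_pos (inv_pos.2 hs)
    have hlog : Real.log w⁻¹ = 2 * Real.log (Real.sqrt w)⁻¹ := by
      rw [Real.log_inv, Real.log_inv, Real.log_sqrt h0]
      ring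
    calc
      w * Real.log w⁻¹ ≤ w * (2 * (Real.sqrt w)⁻¹) := by
        rw [hlog]
        gcongr
        linarith
      _ = 2 * Real.sqrt w := by
        nth_rewrite 1 [← hsq]
        field_simp
  have hright : (1 - w) * Real.log (1 - w)⁻¹ ≤ w := by
    have hw : 0 < 1 - w := by linarith
    calc
      _ ≤ (1 - w) * ((1 - w)⁻¹ - 1) := by
        gcongr
        exact Real.log_le_sub_one_of_pos (inv_pos.2 hw)
      _ = w := by
        field_simp
        ring
  rw [Real.binEntropy]
  nlinarith

lemma binEnt_nonneg {w : ℝ} (h0 : 0 ≤ w) (h1 : w ≤ 1) : 0 ≤ binEnt w := by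
  rw [binEnt_eq_binEntropy_div]
  exact div_nonneg (Real.binEntropy_nonneg h0 h1) (Real.log_nonneg one_le_two)

lemma continuous_binEnt : Continuous binEnt := by
  simp only [funext binEnt_eq_binEntropy_div]
  fun_prop

lemma measurable_binEnt_stdNormalTail : Measurable fun x => binEnt (stdNormalTail x) :=
  continuous_binEnt.measurable.comp antitone_stdNormalTail.measurable

lemma binEnt_stdNormalTail_nonneg (x : ℝ) : 0 ≤ binEnt (stdNormalTail x) :=
  binEnt_nonneg (stdNormalTail_nonneg x) (stdNormalTail_le_one x)

lemma binEnt_stdNormalTail_le (x : ℝ) :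
    binEnt (stdNormalTail x) ≤
      3 * Real.exp (1 / 4) / Real.log 2 * Real.exp (-(1 / 2) * x) := by
  have hlog : 0 < Real.log 2 := Real.log_pos one_lt_two
  have hsqrt : Real.sqrt (stdNormalTail x) ≤ Real.exp (1 / 4) * Real.exp (-(1 / 2) * x) := by
    rw [← Real.exp_add]
    refine Real.sqrt_le_iff.2 ⟨(Real.exp_pos _).le, (stdNormalTail_le_exp x).trans_eq ?_⟩
    rw [← Real.exp_nat_mul]
    congr 1
    push_cast
    ring
  rw [binEnt_eq_binEntropy_div, div_mul_eq_mul_div, mul_assoc]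
  gcongr
  exact (binEntropy_le_three_mul_sqrt (stdNormalTail_nonneg x) (stdNormalTail_le_one x)).trans
    (mul_le_mul_of_nonneg_left hsqrt zero_le_three)

lemma integrableOn_binEnt_stdNormalTail :
    IntegrableOn (fun x => binEnt (stdNormalTail x)) (Set.Ioi 0) := by
  refine Integrable.mono'
    ((integrableOn_exp_mul_Ioi (a := -(1 / 2)) (by norm_num) 0).const_mul
      (3 * Real.exp (1 / 4) / Real.log 2))
    measurable_binEnt_stdNormalTail.aestronglyMeasurable (Eventually.of_forall fun x => ?_)
  rw [Real.norm_of_nonneg (binEnt_stdNormalTail_nonneg x)]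
  exact binEnt_stdNormalTail_le x

/-- As `c → ∞`, `c · ∫₀^∞ √(2/π)·e^{−x²}·H₂(Φ(c·x)) dx` converges to `√(2/π)·α`,
where `α = ∫₀^∞ H₂(Φ(x)) dx`. (The integral is the conditional entropy `I(h(q)|f(p))`
of the sign bit of a Gaussian projection.) -/
theorem entropy_integral_limit :
    Tendsto (fun c : ℝ => c * ∫ x in Set.Ioi (0 : ℝ),
        Real.sqrt (2 / Real.pi) * Real.exp (-(x ^ 2)) * binEnt (stdNormalTail (c * x)))
      atTop
      (nhds (Real.sqrt (2 / Real.pi) * ∫ x in Set.Ioi (0 : ℝ), binEnt (stdNormalTail x))) := by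
  have hscale : ∀ᶠ c : ℝ in atTop,
      ∫ y in Set.Ioi (0 : ℝ),
        Real.sqrt (2 / Real.pi) * Real.exp (-((c⁻¹ * y) ^ 2)) * binEnt (stdNormalTail y) =
      c * ∫ x in Set.Ioi (0 : ℝ),
        Real.sqrt (2 / Real.pi) * Real.exp (-(x ^ 2)) * binEnt (stdNormalTail (c * x)) := by
    filter_upwards [eventually_gt_atTop 0] with c hc
    have h := integral_comp_mul_left_Ioi (fun y => Real.sqrt (2 / Real.pi) *
      Real.exp (-((c⁻¹ * y) ^ 2)) * binEnt (stdNormalTail y)) 0 hc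
    simp only [inv_mul_cancel_left₀ hc.ne', mul_zero, smul_eq_mul] at h
    rw [h, mul_inv_cancel_left₀ hc.ne']
  refine Tendsto.congr' hscale ?_
  rw [← integral_const_mul]
  refine tendsto_integral_filter_of_dominated_convergence
    (fun y => Real.sqrt (2 / Real.pi) * binEnt (stdNormalTail y))
    (Eventually.of_forall fun c => ?_)
    (Eventually.of_forall fun c => Eventually.of_forall fun y => ?_)
    (integrableOn_binEnt_stdNormalTail.const_mul _)
    (Eventually.of_forall fun y => ?_)
  · exact ((by fun_prop : Measurable fun y : ℝ => Real.sqrt (2 / Real.pi) *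
      Real.exp (-((c⁻¹ * y) ^ 2))).mul measurable_binEnt_stdNormalTail).aestronglyMeasurable
  · have hy := binEnt_stdNormalTail_nonneg y
    rw [Real.norm_of_nonneg (by positivity)]
    gcongr
    exact mul_le_of_le_one_right (Real.sqrt_nonneg _)
      (Real.exp_le_one_iff.2 (neg_nonpos.2 (sq_nonneg _)))
  · have hexp : Tendsto (fun c : ℝ => Real.exp (-((c⁻¹ * y) ^ 2))) atTop (nhds 1) := by
      have hcont : Continuous fun u : ℝ => Real.exp (-((u * y) ^ 2)) := by fun_prop
      simpa [Function.comp_def] using (hcont.tendsto 0).comp tendsto_inv_atTop_zero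
    simpa using (hexp.const_mul (Real.sqrt (2 / Real.pi))).mul_const (binEnt (stdNormalTail y))
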